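/- arXiv:1104.3007 — 6 statements merged into one kernel-verified Lean document; each statement's English description precedes it below -/
import Mathlib

section
/- Let M = (Q, Σ, q₀, δ, F) be a minimal DFA such that K_{q₀} ≠ ∅, and let N be a DFA that is hyper-minimal for M. Then there exists a kernel state q ∈ K_{q₀} such that L(N) = L(q, M), and consequently |L(M) △ L(N)| = |L(q₀, M) △ L(q, M)|. -/
open scoped Classical

/-- The left language of state `q`: all strings taking `M` from its start state into `q`. -/
def leftLang {α σ : Type*} (M : DFA α σ) (q : σ) : Set (List α) :=
  {w | M.evalFrom M.start w = q}

/-- The right language of state `q`: all strings taking `M` from `q` into a final state. -/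
def rightLang {α σ : Type*} (M : DFA α σ) (q : σ) : Set (List α) :=
  {w | M.evalFrom q w ∈ M.accept}

/-- The language of `M`. -/
def lang {α σ : Type*} (M : DFA α σ) : Set (List α) :=
  rightLang M M.start

/-- States `q` and `p` of `M` are almost-equivalent if their right languages
are almost-equal. -/
def AlmostEq {α σ : Type*} (M : DFA α σ) (q p : σ) : Prop :=
  (symmDiff (rightLang M q) (rightLang M p)).Finite

/-- A kernel state: its left language is infinite. -/
def Kernel {α σ : Type*} (M : DFA α σ) (q : σ) : Prop :=
  (leftLang M q).Infinite

/-- A preamble state: its left language is finite. -/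
def Preamble {α σ : Type*} (M : DFA α σ) (q : σ) : Prop :=
  (leftLang M q).Finite

/-- `M` is minimal: every state is reachable and distinct states have distinct
right languages. -/
def MinimalDFA {α σ : Type*} (M : DFA α σ) : Prop :=
  (∀ q, (leftLang M q).Nonempty) ∧ ∀ q p, rightLang M q = rightLang M p → q = p

/-- `M` is hyper-minimal: it is minimal and has no pair of distinct almost-equivalent
states of which at least one is a preamble state. -/
def HyperMinimal {α σ : Type*} (M : DFA α σ) : Prop :=
  MinimalDFA M ∧ ¬ ∃ q p, q ≠ p ∧ AlmostEq M q p ∧ (Preamble M q ∨ Preamble M p)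

/-- `K_q`: the set of kernel states almost-equivalent to `q`. -/
def Kq {α σ : Type*} (M : DFA α σ) (q : σ) : Set σ :=
  {p | Kernel M p ∧ AlmostEq M p q}

/-- `P_∼`: the set of equivalence classes of the almost-equivalence consisting
exclusively of preamble states. -/
def Psim {α σ : Type*} (M : DFA α σ) : Set (Set σ) :=
  {B | (∃ q, B = {p | AlmostEq M q p}) ∧ ∀ p ∈ B, Preamble M p}

/-- `W_B`: the union of the left languages of the states of `B`. -/
def WB {α σ : Type*} (M : DFA α σ) (B : Set σ) : Set (List α) :=
  ⋃ q ∈ B, leftLang M q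

/-- `W_{B,σ}`: the strings `uσw` with `u ∈ W_B`. -/
def WBs {α σ : Type*} (M : DFA α σ) (B : Set σ) (a : α) : Set (List α) :=
  {w | ∃ u v, u ∈ WB M B ∧ w = u ++ a :: v}

theorem aux_quot {α σ : Type*} (M : DFA α σ) (w v : List α) :
    v ∈ rightLang M (M.evalFrom M.start w) ↔ w ++ v ∈ lang M := by
  simp [rightLang, lang, DFA.evalFrom_of_append]

theorem aux_trans {β : Type*} {A B C : Set β} (h1 : (symmDiff A B).Finite)
    (h2 : (symmDiff B C).Finite) : (symmDiff A C).Finite :=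
  (h1.union h2).subset (symmDiff_triangle A B C)

theorem aux_pre {α : Type*} {D : Set (List α)} (hD : D.Finite) :
    {w : List α | ∃ v, w ++ v ∈ D}.Finite := by
  have : {w : List α | ∃ v, w ++ v ∈ D} ⊆ ⋃ d ∈ D, {w | w ∈ d.inits} := by
    rintro w ⟨v, hv⟩
    simp only [Set.mem_iUnion, Set.mem_setOf_eq, List.mem_inits]
    exact ⟨_, hv, v, rfl⟩
  exact (hD.biUnion fun d _ => List.finite_toSet _).subset this

theorem stmt11 {α σ σ' : Type*} [Fintype α] [Fintype σ] [Fintype σ']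
    (M : DFA α σ) (hM : MinimalDFA M) (hK : (Kq M M.start).Nonempty)
    (N : DFA α σ') (hN : HyperMinimal N)
    (hae : (symmDiff (lang M) (lang N)).Finite) :
    ∃ q ∈ Kq M M.start, lang N = rightLang M q ∧
      (symmDiff (lang M) (lang N)).ncard =
        (symmDiff (rightLang M M.start) (rightLang M q)).ncard := by
  have hker : Kernel N N.start := by
    intro hfin
    obtain ⟨p, hp, hpq⟩ := hK
    apply hp
    refine Set.Finite.subset hfin ?_
    intro w hw
    have hw : M.evalFrom M.start w = p := hw
    by_contra hne
    refine hN.2 ⟨N.evalFrom N.start w, N.start, hne, ?_, Or.inr hfin⟩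
    have h1 : (symmDiff (rightLang N (N.evalFrom N.start w)) (rightLang M p)).Finite := by
      refine Set.Finite.subset (hae.preimage (f := fun v => w ++ v)
        (fun a _ b _ h => List.append_cancel_left h)) ?_
      intro v hv
      rw [← hw] at hv
      simp only [Set.mem_symmDiff, aux_quot] at hv
      simp only [Set.mem_preimage, Set.mem_symmDiff]
      tauto
    exact aux_trans h1 (aux_trans hpq hae)
  have hinf := Set.Infinite.diff hker (aux_pre hae)
  obtain ⟨q, hq⟩ : ∃ q, ((leftLang N N.start \ {w | ∃ v, w ++ v ∈ symmDiff (lang M) (lang N)})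
      ∩ leftLang M q).Infinite := by
    by_contra hcon
    push Not at hcon
    refine hinf ((Set.finite_iUnion fun q => Set.not_infinite.1 (by simpa using hcon q)).subset ?_)
    intro w hw
    exact Set.mem_iUnion.2 ⟨M.evalFrom M.start w, hw, rfl⟩
  obtain ⟨w, ⟨hw1, hw2⟩, hw3⟩ := hq.nonempty
  have hw1 : N.evalFrom N.start w = N.start := hw1
  have hw3 : M.evalFrom M.start w = q := hw3
  have heq : lang N = rightLang M q := by
    ext v
    have h1 := aux_quot M w v
    have h2 := aux_quot N w v
    rw [hw1] at h2
    rw [hw3] at h1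
    have h3 : ¬ (w ++ v ∈ symmDiff (lang M) (lang N)) := fun h => hw2 ⟨v, h⟩
    rw [Set.mem_symmDiff] at h3
    change v ∈ rightLang N N.start ↔ _
    tauto
  refine ⟨q, ⟨hq.mono Set.inter_subset_right, ?_⟩, heq, ?_⟩
  · unfold AlmostEq
    rw [← heq, symmDiff_comm]
    exact hae
  · rw [heq]; rfl
end

section
/- Let M = (Q, Σ, q₀, δ, F) be a minimal DFA such that some kernel state of M is almost-equivalent to the initial state q₀, and let N be a DFA that is hyper-minimal for M. Then N has no preamble states: every state of N is a kernel state of N. -/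
theorem stmt12 {α σ σ' : Type*} [Fintype α] [Fintype σ] [Fintype σ']
    (M : DFA α σ) (hM : MinimalDFA M)
    (h : ∃ k, Kernel M k ∧ AlmostEq M k M.start)
    (N : DFA α σ') (hN : HyperMinimal N)
    (hae : (symmDiff (lang M) (lang N)).Finite) :
    ∀ p : σ', Kernel N p := by
  classical
  have tri : ∀ {A B C : Set (List α)}, (symmDiff A B).Finite → (symmDiff B C).Finite →
      (symmDiff A C).Finite := fun {A B C} h1 h2 =>
    (h1.union h2).subset (symmDiff_triangle A B C)
  obtain ⟨k, hk, hks⟩ := h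
  -- pigeonhole
  obtain ⟨q, hq⟩ : ∃ q, (leftLang M k ∩ leftLang N q).Infinite := by
    by_contra hcon
    push Not at hcon
    apply hk
    refine (Set.finite_iUnion hcon).subset ?_
    intro w hw
    exact Set.mem_iUnion.2 ⟨N.evalFrom N.start w, hw, rfl⟩
  have hqK : Kernel N q := hq.mono Set.inter_subset_right
  obtain ⟨w, hwM, hwN⟩ := hq.nonempty
  have hwM' : M.evalFrom M.start w = k := hwM
  have hwN' : N.evalFrom N.start w = q := hwN
  have h1 : (symmDiff (rightLang M k) (rightLang N q)).Finite := by
    refine (hae.preimage (f := fun v => w ++ v)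
      (fun a _ b _ hab => List.append_cancel_left hab)).subset ?_
    intro v hv
    simpa [Set.mem_symmDiff, lang, rightLang, DFA.evalFrom_of_append, hwM', hwN'] using hv
  have h2 : AlmostEq N q N.start :=
    tri (by rw [symmDiff_comm]; exact h1) (tri hks hae)
  have hs : Kernel N N.start := by
    by_cases he : q = N.start
    · exact he ▸ hqK
    · intro hfin
      exact hN.2 ⟨q, N.start, he, h2, Or.inr hfin⟩
  intro p
  obtain ⟨u, hu⟩ := hN.1.1 p
  have hu' : N.evalFrom N.start u = p := hu
  refine (Set.Infinite.image (f := fun v => v ++ u)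
    (fun a _ b _ hab => List.append_cancel_right hab) hs).mono ?_
  rintro _ ⟨v, hv, rfl⟩
  have hv' : N.evalFrom N.start v = N.start := hv
  simp [leftLang, DFA.evalFrom_of_append, hv', hu']
end

section
/- Let M = (Q, Σ, q₀, δ, F) be a minimal DFA, let B ∈ P_∼, and let N be a DFA that is hyper-minimal for M. Then the cardinality of (L(M) △ L(N)) ∩ W_B equals either Σ_{q ∈ B ∩ F} |L(M, q)| or Σ_{q ∈ B \ F} |L(M, q)|. -/
open scoped Classical

theorem ncard_union_left {α σ : Type*} [Fintype σ] (M : DFA α σ) (P : σ → Prop) [DecidablePred P]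
    (hP : ∀ q, P q → (leftLang M q).Finite) :
    {w | P (M.evalFrom M.start w)}.ncard =
      ∑ q ∈ Finset.univ.filter (fun q => P q), (leftLang M q).ncard := by
  have hfin : {w | P (M.evalFrom M.start w)}.Finite := by
    have : {w | P (M.evalFrom M.start w)} = ⋃ q ∈ {q | P q}, leftLang M q := by
      ext w; simp [leftLang]
    rw [this]
    exact Set.Finite.biUnion (Set.toFinite _) hP
  rw [Set.ncard_eq_toFinset_card _ hfin,
    Finset.card_eq_sum_card_fiberwise (f := fun w => M.evalFrom M.start w)
      (t := Finset.univ.filter (fun q => P q)) (by intro w hw; simpa using hw)]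
  refine Finset.sum_congr rfl fun q hq => ?_
  rw [← Set.ncard_coe_finset]
  congr 1
  ext w
  simp only [Finset.mem_filter, Finset.mem_univ, true_and] at hq
  simp only [Finset.coe_filter, Set.Finite.mem_toFinset, Set.mem_setOf_eq, leftLang]
  constructor
  · exact fun h => h.2
  · intro h; exact ⟨h ▸ hq, h⟩

theorem fin_trans {β : Type*} {A B C : Set β} (h : (symmDiff A B).Finite)
    (h' : (symmDiff B C).Finite) : (symmDiff A C).Finite :=
  (h.union h').subset (symmDiff_triangle A B C)

theorem fin_resid {α σ σ' : Type*} (M : DFA α σ) (N : DFA α σ')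
    (hae : (symmDiff (lang M) (lang N)).Finite) (w : List α) :
    (symmDiff (rightLang M (M.evalFrom M.start w))
      (rightLang N (N.evalFrom N.start w))).Finite := by
  have : symmDiff (rightLang M (M.evalFrom M.start w))
      (rightLang N (N.evalFrom N.start w)) =
      (fun v => w ++ v) ⁻¹' (symmDiff (lang M) (lang N)) := by
    ext v
    simp [Set.mem_symmDiff, lang, rightLang, DFA.evalFrom_of_append]
  rw [this]
  exact hae.preimage (fun a _ b _ h => List.append_cancel_left h)

theorem stmt13 {α σ σ' : Type*} [Fintype α] [Fintype σ] [Fintype σ']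
    (M : DFA α σ) (hM : MinimalDFA M) (B : Set σ) (hB : B ∈ Psim M)
    (N : DFA α σ') (hN : HyperMinimal N)
    (hae : (symmDiff (lang M) (lang N)).Finite) :
    ((symmDiff (lang M) (lang N)) ∩ WB M B).ncard =
        ∑ q ∈ Finset.univ.filter (fun q => q ∈ B ∧ q ∈ M.accept),
          (leftLang M q).ncard ∨
      ((symmDiff (lang M) (lang N)) ∩ WB M B).ncard =
        ∑ q ∈ Finset.univ.filter (fun q => q ∈ B ∧ q ∉ M.accept),
          (leftLang M q).ncard := by
  obtain ⟨⟨q0, rfl⟩, hpre⟩ := hB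
  have hfr := fin_resid M N hae
  have hpreN : ∀ w, AlmostEq M q0 (M.evalFrom M.start w) →
      Preamble N (N.evalFrom N.start w) := by
    intro w hw
    by_contra hk
    apply hk
    have hsub : leftLang N (N.evalFrom N.start w) ⊆
        ⋃ q ∈ {p | AlmostEq M q0 p}, leftLang M q := by
      intro u hu
      have hu' : N.evalFrom N.start u = N.evalFrom N.start w := hu
      simp only [Set.mem_iUnion]
      refine ⟨M.evalFrom M.start u, ?_, rfl⟩
      have h1 := hfr u
      rw [hu', symmDiff_comm] at h1
      exact fin_trans hw (fin_trans (hfr w) h1)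
    exact (Set.Finite.biUnion (Set.toFinite _) hpre).subset hsub
  obtain ⟨w0, hw0⟩ := hM.1 q0
  have hw0' : M.evalFrom M.start w0 = q0 := hw0
  have hq0 : AlmostEq M q0 (M.evalFrom M.start w0) := by
    rw [hw0']; simp [AlmostEq]
  have huniq : ∀ w, AlmostEq M q0 (M.evalFrom M.start w) →
      N.evalFrom N.start w = N.evalFrom N.start w0 := by
    intro w hw
    by_contra hne
    refine hN.2 ⟨_, _, hne, ?_, Or.inl (hpreN w hw)⟩
    have h1 := hfr w
    have h2 := hfr w0
    have h3 : (symmDiff (rightLang M (M.evalFrom M.start w)) (rightLang M q0)).Finite := by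
      rw [symmDiff_comm]; exact hw
    rw [symmDiff_comm] at h1
    rw [hw0'] at h2
    exact fin_trans h1 (fin_trans h3 h2)
  by_cases hacc : N.evalFrom N.start w0 ∈ N.accept
  · right
    rw [← ncard_union_left M (fun q => q ∈ {p | AlmostEq M q0 p} ∧ q ∉ M.accept)
      (fun q hq => hpre q hq.1)]
    congr 1
    ext w
    have := huniq w
    simp only [Set.mem_inter_iff, Set.mem_symmDiff, WB, leftLang, Set.mem_iUnion, lang, rightLang,
      Set.mem_setOf_eq, exists_prop, exists_eq_right']
    grind
  · left
    rw [← ncard_union_left M (fun q => q ∈ {p | AlmostEq M q0 p} ∧ q ∈ M.accept)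
      (fun q hq => hpre q hq.1)]
    congr 1
    ext w
    have := huniq w
    simp only [Set.mem_inter_iff, Set.mem_symmDiff, WB, leftLang, Set.mem_iUnion, lang, rightLang,
      Set.mem_setOf_eq, exists_prop, exists_eq_right']
    grind
end

section
/- Let M = (Q, Σ, q₀, δ, F) be a minimal DFA, let B ∈ P_∼ and σ ∈ Σ be such that K = ⋃_{q ∈ B} K_{δ(q, σ)} ≠ ∅, and let N be a DFA that is hyper-minimal for M. Then there exists q' ∈ K such that |(L(M) △ L(N)) ∩ W_{B,σ}| = Σ_{q ∈ B} |L(M, q)| · |L(δ(q, σ), M) △ L(q', M)|. -/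
open scoped Classical

theorem ae_trans {X : Type*} {A B C : Set X} (h : (symmDiff A B).Finite)
    (h' : (symmDiff B C).Finite) : (symmDiff A C).Finite :=
  (h.union h').subset (symmDiff_triangle A B C)

theorem ae_symm {X : Type*} {A B : Set X} (h : (symmDiff A B).Finite) :
    (symmDiff B A).Finite := by rwa [symmDiff_comm]

theorem ae_right {α σ σ' : Type*} (M : DFA α σ) (N : DFA α σ') (p : σ) (q : σ') (u : List α)
    (h : (symmDiff (rightLang M p) (rightLang N q)).Finite) :
    (symmDiff (rightLang M (M.evalFrom p u)) (rightLang N (N.evalFrom q u))).Finite := by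
  have h2 := h.preimage (f := fun v => u ++ v) (fun x _ y _ hxy => List.append_cancel_left hxy)
  refine h2.subset ?_
  intro v hv
  simpa [Set.mem_symmDiff, rightLang, DFA.evalFrom_of_append] using hv

theorem exists_pair {α σ σ' : Type*} [Finite σ'] (M : DFA α σ) (N : DFA α σ') (p : σ)
    (hp : Kernel M p) : ∃ s, (leftLang M p ∩ leftLang N s).Infinite := by
  by_contra hcon
  push Not at hcon
  apply hp
  refine (Set.finite_iUnion hcon).subset ?_
  intro w hw
  exact Set.mem_iUnion.2 ⟨_, hw, rfl⟩

theorem ae_of_mem {α σ σ' : Type*} (M : DFA α σ) (N : DFA α σ')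
    (hae : (symmDiff (lang M) (lang N)).Finite) (p : σ) (s : σ') (w : List α)
    (h1 : w ∈ leftLang M p) (h2 : w ∈ leftLang N s) :
    (symmDiff (rightLang M p) (rightLang N s)).Finite := by
  have := ae_right M N M.start N.start w hae
  rw [show M.evalFrom M.start w = p from h1, show N.evalFrom N.start w = s from h2] at this
  exact this

theorem eq_of_inf {α σ σ' : Type*} (M : DFA α σ) (N : DFA α σ')
    (hae : (symmDiff (lang M) (lang N)).Finite) (p : σ) (s : σ')
    (h : (leftLang M p ∩ leftLang N s).Infinite) : rightLang M p = rightLang N s := by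
  rw [← symmDiff_eq_bot]
  rw [Set.bot_eq_empty, Set.eq_empty_iff_forall_notMem]
  intro v hv
  apply h
  have h2 := hae.preimage (f := fun w => w ++ v) (fun x _ y _ hxy => List.append_cancel_right hxy)
  refine h2.subset ?_
  rintro w ⟨hw1, hw2⟩
  have hw1 : M.evalFrom M.start w = p := hw1
  have hw2 : N.evalFrom N.start w = s := hw2
  simpa [Set.mem_symmDiff, lang, rightLang, DFA.evalFrom_of_append, hw1, hw2] using hv

theorem loop_kernel {α σ : Type*} (N : DFA α σ) (n : σ) (u y : List α) (hy : y ≠ [])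
    (h1 : u ∈ leftLang N n) (h2 : N.evalFrom n y = n) : Kernel N n := by
  have h3 : ∀ k : ℕ, N.evalFrom n (List.replicate k y).flatten = n := by
    intro k
    induction k with
    | zero => simp
    | succ k ih => rw [List.replicate_succ, List.flatten_cons, DFA.evalFrom_of_append, h2, ih]
  refine Set.infinite_of_injective_forall_mem
    (f := fun k : ℕ => u ++ (List.replicate k y).flatten) ?_ ?_
  · intro k l hkl
    have := congrArg List.length hkl
    have hl : 0 < y.length := List.length_pos_iff.2 hy
    simp at this
    rcases this with h | h
    · exact h
    · exact absurd h hy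
  · intro k
    have h1 : N.evalFrom N.start u = n := h1
    show N.evalFrom N.start (u ++ (List.replicate k y).flatten) = n
    rw [DFA.evalFrom_of_append, h1, h3]

theorem stmt15 {α σ σ' : Type*} [Fintype α] [Fintype σ] [Fintype σ']
    (M : DFA α σ) (hM : MinimalDFA M) (B : Set σ) (a : α) (hB : B ∈ Psim M)
    (hK : (⋃ q ∈ B, Kq M (M.step q a)).Nonempty)
    (N : DFA α σ') (hN : HyperMinimal N)
    (hae : (symmDiff (lang M) (lang N)).Finite) :
    ∃ q' ∈ ⋃ q ∈ B, Kq M (M.step q a),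
      ((symmDiff (lang M) (lang N)) ∩ WBs M B a).ncard =
        ∑ q ∈ Finset.univ.filter (fun q => q ∈ B),
          (leftLang M q).ncard *
            (symmDiff (rightLang M (M.step q a)) (rightLang M q')).ncard := by
  obtain ⟨⟨q0, hq0⟩, hpre⟩ := hB
  have hBae : ∀ p ∈ B, ∀ q ∈ B, AlmostEq M p q := by
    intro p hp q hq
    rw [hq0] at hp hq
    exact ae_trans (ae_symm hp) hq
  have hBcl : ∀ p ∈ B, ∀ q, AlmostEq M p q → q ∈ B := by
    intro p hp q hq
    rw [hq0] at hp ⊢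
    exact ae_trans hp hq
  obtain ⟨p, hp⟩ := hK
  simp only [Set.mem_iUnion] at hp
  obtain ⟨b, hb, hpK, hpb⟩ := hp
  obtain ⟨ub, hub⟩ := hM.1 b
  obtain ⟨n, hn⟩ : ∃ n, n = N.evalFrom N.start ub := ⟨_, rfl⟩
  have hbn : (symmDiff (rightLang M b) (rightLang N n)).Finite :=
    ae_of_mem M N hae b n ub hub hn.symm
  have haeN : (symmDiff (lang N) (lang M)).Finite := ae_symm hae
  have hnpre : Preamble N n := by
    by_contra hk
    obtain ⟨s, hs⟩ := exists_pair N M n hk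
    have h1 := eq_of_inf N M haeN n s hs
    have hsB : s ∈ B := hBcl b hb s (by rw [h1] at hbn; exact hbn)
    exact hs ((hpre s hsB).subset Set.inter_subset_right)
  have hNB : ∀ q ∈ B, ∀ u ∈ leftLang M q, N.evalFrom N.start u = n := by
    intro q hq u hu
    have h1 := ae_of_mem M N hae q _ u hu rfl
    have h2 : AlmostEq N n (N.evalFrom N.start u) :=
      ae_trans (ae_symm hbn) (ae_trans (hBae b hb q hq) h1)
    by_contra hne
    exact hN.2 ⟨n, _, fun h => hne h.symm, h2, Or.inl hnpre⟩
  have hstep : ∀ q ∈ B, (symmDiff (rightLang M (M.step q a))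
      (rightLang N (N.step n a))).Finite := by
    intro q hq
    have := ae_right M N q n [a] (ae_trans (hBae q hq b hb) hbn)
    simpa using this
  have hkn : Kernel N (N.step n a) := by
    obtain ⟨s, hs⟩ := exists_pair M N p hpK
    have h1 := eq_of_inf M N hae p s hs
    have h2 : AlmostEq N s (N.step n a) := by
      have := ae_trans hpb (hstep b hb)
      rw [h1] at this
      exact this
    have hsk : Kernel N s := hs.mono Set.inter_subset_right
    by_cases he : s = N.step n a
    · rwa [← he]
    · intro hf
      exact hN.2 ⟨s, _, he, h2, Or.inr hf⟩
  obtain ⟨q', hq'⟩ := exists_pair N M _ hkn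
  have hq'e := eq_of_inf N M haeN _ _ hq'
  rw [hq'e] at hstep
  refine ⟨q', ?_, ?_⟩
  · simp only [Set.mem_iUnion]
    exact ⟨b, hb, hq'.mono Set.inter_subset_right, ae_symm (hstep b hb)⟩
  -- counting
  have hnoloop : ∀ q1 ∈ B, ∀ q2 ∈ B, ∀ u1 ∈ leftLang M q1, ∀ u2 ∈ leftLang M q2,
      ∀ y, u2 = u1 ++ y → y = [] := by
    intro q1 h1 q2 h2 u1 hu1 u2 hu2 y hy
    by_contra hne
    have e1 := hNB q1 h1 u1 hu1
    have e2 := hNB q2 h2 u2 hu2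
    rw [hy, DFA.evalFrom_of_append, e1] at e2
    exact loop_kernel N n u1 y hne e1 e2 hnpre
  set D : σ → Set (List α) :=
    fun q => symmDiff (rightLang M (M.step q a)) (rightLang M q') with hD
  let f : List α × List α → List α := fun x => x.1 ++ a :: x.2
  let F := Finset.univ.filter (fun q => q ∈ B)
  let T : Set (List α × List α) := ⋃ q ∈ F, leftLang M q ×ˢ D q
  have hS : (symmDiff (lang M) (lang N)) ∩ WBs M B a = f '' T := by
    have key : ∀ q ∈ B, ∀ u ∈ leftLang M q, ∀ v,
        (u ++ a :: v ∈ symmDiff (lang M) (lang N) ↔ v ∈ D q) := by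
      intro q hq u hu v
      have e1 : M.evalFrom M.start u = q := hu
      have e2 := hNB q hq u hu
      have e3 : ∀ (v : List α), v ∈ rightLang N (N.step n a) ↔ v ∈ rightLang M q' := by
        intro v; rw [hq'e]
      have e4 : u ++ a :: v ∈ lang M ↔ v ∈ rightLang M (M.step q a) := by
        simp [lang, rightLang, DFA.evalFrom_of_append, e1, DFA.evalFrom_cons]
      have e5 : u ++ a :: v ∈ lang N ↔ v ∈ rightLang M q' := by
        rw [← e3]
        simp [lang, rightLang, DFA.evalFrom_of_append, e2, DFA.evalFrom_cons]
      simp only [hD, Set.mem_symmDiff, e4, e5]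
    ext x
    constructor
    · rintro ⟨hx, u, v, hu, rfl⟩
      simp only [WB, Set.mem_iUnion] at hu
      obtain ⟨q, hq, hu⟩ := hu
      refine ⟨(u, v), ?_, rfl⟩
      simp only [T, F, Set.mem_iUnion]
      exact ⟨q, by simpa using hq, hu, (key q hq u hu v).1 hx⟩
    · rintro ⟨⟨u, v⟩, hT, rfl⟩
      simp only [T, F, Set.mem_iUnion] at hT
      obtain ⟨q, hq, hu, hv⟩ := hT
      have hq : q ∈ B := by simpa using hq
      refine ⟨(key q hq u hu v).2 hv, u, v, ?_, rfl⟩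
      simp only [WB, Set.mem_iUnion]
      exact ⟨q, hq, hu⟩
  have hinj : Set.InjOn f T := by
    rintro ⟨u1, v1⟩ h1 ⟨u2, v2⟩ h2 h
    simp only [T, F, Set.mem_iUnion] at h1 h2
    obtain ⟨q1, hq1, hu1, -⟩ := h1
    obtain ⟨q2, hq2, hu2, -⟩ := h2
    have hq1 : q1 ∈ B := by simpa using hq1
    have hq2 : q2 ∈ B := by simpa using hq2
    have h : u1 ++ a :: v1 = u2 ++ a :: v2 := h
    have hu : u1 = u2 := by
      rcases List.append_eq_append_iff.1 h with ⟨y, hy, -⟩ | ⟨y, hy, -⟩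
      · have := hnoloop q1 hq1 q2 hq2 u1 hu1 u2 hu2 y hy
        simp [hy, this]
      · have := hnoloop q2 hq2 q1 hq1 u2 hu2 u1 hu1 y hy
        simp [hy, this]
    subst hu
    have := List.append_cancel_left h
    simp at this
    rw [this]
  rw [hS, Set.ncard_image_of_injOn hinj]
  have hfin : ∀ q ∈ B, (leftLang M q ×ˢ D q).Finite := fun q hq => (hpre q hq).prod (hstep q hq)
  have hgen : ∀ G : Finset σ, (∀ q ∈ G, q ∈ B) →
      (⋃ q ∈ G, leftLang M q ×ˢ D q).Finite ∧
      (⋃ q ∈ G, leftLang M q ×ˢ D q).ncard = ∑ q ∈ G, (leftLang M q).ncard * (D q).ncard := by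
    intro G
    induction G using Finset.induction_on with
    | empty => simp
    | insert q G hq ih =>
      intro hG
      obtain ⟨i1, i2⟩ := ih (fun r hr => hG r (Finset.mem_insert_of_mem hr))
      have hfq := hfin q (hG q (Finset.mem_insert_self _ _))
      rw [Finset.set_biUnion_insert]
      refine ⟨hfq.union i1, ?_⟩
      rw [Set.ncard_union_eq ?_ hfq i1, i2, Finset.sum_insert hq, Set.ncard_prod]
      rw [Set.disjoint_left]
      rintro ⟨u, v⟩ ⟨hu, -⟩ h2
      simp only [Set.mem_iUnion] at h2
      obtain ⟨r, hr, hu2, -⟩ := h2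
      have hu : M.evalFrom M.start u = q := hu
      have hu2 : M.evalFrom M.start u = r := hu2
      exact hq (by rw [← hu, hu2]; exact hr)
  exact (hgen F (fun q hq => by simpa [F] using hq)).2
end

section
/- Let M = (Q, Σ, q₀, δ, F) be a minimal DFA, let B ∈ P_∼ and σ ∈ Σ be such that K = ⋃_{q ∈ B} K_{δ(q, σ)} ≠ ∅, and let N be a DFA that is hyper-minimal for M. Then there exists q' ∈ K such that (L(M) △ L(N)) ∩ W_{B,σ} = ⋃_{q ∈ B} { uσv : u ∈ L(M, q), v ∈ L(δ(q, σ), M) △ L(q', M) }. -/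
theorem h_ae_symm {α : Type*} {S T : Set α} (h : (symmDiff S T).Finite) :
    (symmDiff T S).Finite := by rwa [symmDiff_comm]

theorem h_ae_trans {α : Type*} {S T U : Set α} (h : (symmDiff S T).Finite)
    (h2 : (symmDiff T U).Finite) : (symmDiff S U).Finite :=
  (h.union h2).subset (symmDiff_triangle S T U)

theorem h_mem_right {α σ : Type*} (M : DFA α σ) (q : σ) (u v : List α) :
    v ∈ rightLang M (M.evalFrom q u) ↔ u ++ v ∈ rightLang M q := by
  simp [rightLang, DFA.evalFrom_of_append]

theorem h_quot {α σ σ' : Type*} (M : DFA α σ) (N : DFA α σ') (q : σ) (p : σ')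
    (h : (symmDiff (rightLang M q) (rightLang N p)).Finite) (u : List α) :
    (symmDiff (rightLang M (M.evalFrom q u)) (rightLang N (N.evalFrom p u))).Finite := by
  have := h.preimage (f := fun v => u ++ v) (List.append_right_injective u).injOn
  refine this.subset ?_
  intro v hv
  simpa only [Set.mem_preimage, Set.mem_symmDiff, h_mem_right] using hv

theorem h_fin {α σ : Type*} [Fintype σ] (M : DFA α σ) (P : σ → Prop)
    (h : ∀ s, P s → Preamble M s) : {w | P (M.evalFrom M.start w)}.Finite := by
  have : (⋃ s ∈ {s | P s}, leftLang M s).Finite :=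
    (Set.toFinite {s | P s}).biUnion (fun s hs => h s hs)
  refine this.subset ?_
  intro w hw
  simp only [Set.mem_iUnion]
  exact ⟨_, hw, rfl⟩

theorem stmt16 {α σ σ' : Type*} [Fintype α] [Fintype σ] [Fintype σ']
    (M : DFA α σ) (hM : MinimalDFA M) (B : Set σ) (a : α) (hB : B ∈ Psim M)
    (hK : (⋃ q ∈ B, Kq M (M.step q a)).Nonempty)
    (N : DFA α σ') (hN : HyperMinimal N)
    (hae : (symmDiff (lang M) (lang N)).Finite) :
    ∃ q' ∈ ⋃ q ∈ B, Kq M (M.step q a),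
      (symmDiff (lang M) (lang N)) ∩ WBs M B a =
        ⋃ q ∈ B, {w | ∃ u v, u ∈ leftLang M q ∧
          v ∈ symmDiff (rightLang M (M.step q a)) (rightLang M q') ∧
          w = u ++ a :: v} := by
  obtain ⟨⟨b, hb⟩, hpre⟩ := hB
  have hmem : ∀ q, q ∈ B ↔ AlmostEq M b q := fun q => by rw [hb]; rfl
  have hMN : ∀ u, (symmDiff (rightLang M (M.evalFrom M.start u))
      (rightLang N (N.evalFrom N.start u))).Finite := h_quot M N _ _ hae
  obtain ⟨p, hp⟩ := hK
  simp only [Set.mem_iUnion] at hp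
  obtain ⟨q0, hq0, hpk, hpa⟩ := hp
  obtain ⟨u0, hu0⟩ := hM.1 q0
  have hu0' : M.evalFrom M.start u0 = q0 := hu0
  have hWfin : {w | M.evalFrom M.start w ∈ B}.Finite := h_fin M (· ∈ B) hpre
  -- states of N almost equivalent to b are preamble
  have hNpre : ∀ n, (symmDiff (rightLang M b) (rightLang N n)).Finite → Preamble N n := by
    intro n hn
    refine hWfin.subset ?_
    intro w hw
    have hw' : N.evalFrom N.start w = n := hw
    have := hMN w
    rw [hw'] at this
    exact (hmem _).2 (h_ae_trans hn (h_ae_symm this))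
  have huniq : ∀ u, M.evalFrom M.start u ∈ B →
      N.evalFrom N.start u = N.evalFrom N.start u0 := by
    intro u hu
    have h1 := h_ae_trans ((hmem _).1 hu) (hMN u)
    have h2 := h_ae_trans ((hmem _).1 (hu0'.symm ▸ hq0)) (hMN u0)
    by_contra hne
    exact hN.2 ⟨_, _, hne, h_ae_trans (h_ae_symm h1) h2, Or.inl (hNpre _ h1)⟩
  obtain ⟨n', hn'⟩ : ∃ n', n' = N.evalFrom N.start (u0 ++ [a]) := ⟨_, rfl⟩
  have hstepM : ∀ u, M.evalFrom M.start (u ++ [a]) = M.step (M.evalFrom M.start u) a :=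
    fun u => by simp
  have hn'a : (symmDiff (rightLang M (M.step q0 a)) (rightLang N n')).Finite := by
    have := hMN (u0 ++ [a])
    rwa [hstepM, hu0', ← hn'] at this
  have hpn : (symmDiff (rightLang M p) (rightLang N n')).Finite := h_ae_trans hpa hn'a
  have hn'k : Kernel N n' := by
    intro hfin
    apply hpk
    refine (h_fin N (fun s => (symmDiff (rightLang N n') (rightLang N s)).Finite) ?_).subset ?_
    · intro s hs
      have : n' = s := by
        by_contra hne
        exact hN.2 ⟨_, _, hne, hs, Or.inl hfin⟩
      exact this ▸ hfin
    · intro w hw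
      have hw' : M.evalFrom M.start w = p := hw
      have := hMN w
      rw [hw'] at this
      exact h_ae_trans (h_ae_symm hpn) this
  obtain ⟨k, hk⟩ : ∃ k, ∀ w ∈ symmDiff (lang M) (lang N), w.length ≤ k := by
    obtain ⟨k, hk⟩ := (hae.image List.length).bddAbove
    exact ⟨k, fun w hw => hk ⟨w, hw, rfl⟩⟩
  have hinf : (leftLang N n' \ {w | w.length ≤ k}).Infinite :=
    Set.Infinite.diff hn'k (List.finite_length_le α k)
  have hex : ∀ w ∈ leftLang N n' \ {w | w.length ≤ k},
      rightLang M (M.evalFrom M.start w) = rightLang N n' := by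
    rintro w ⟨hw, hl⟩
    have hw' : N.evalFrom N.start w = n' := hw
    ext v
    rw [← hw', h_mem_right, h_mem_right]
    by_contra hne
    have h1 : w ++ v ∈ symmDiff (lang M) (lang N) := by
      rw [Set.mem_symmDiff]
      unfold lang
      tauto
    have := hk _ h1
    simp only [Set.mem_setOf_eq] at hl
    rw [List.length_append] at this
    omega
  obtain ⟨w0, hw0⟩ := hinf.nonempty
  have hq' := hex w0 hw0
  refine ⟨M.evalFrom M.start w0, ?_, ?_⟩
  · simp only [Set.mem_iUnion]
    refine ⟨q0, hq0, ?_, ?_⟩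
    · refine hinf.mono ?_
      intro w hw
      exact hM.2 _ _ ((hex w hw).trans hq'.symm)
    · unfold AlmostEq
      rw [hq']
      exact h_ae_symm hn'a
  · rw [hq']
    have key : ∀ u v, M.evalFrom M.start u ∈ B →
        (u ++ a :: v ∈ symmDiff (lang M) (lang N) ↔
          v ∈ symmDiff (rightLang M (M.step (M.evalFrom M.start u) a)) (rightLang N n')) := by
      intro u v hu
      have h1 : n' = N.evalFrom N.start (u ++ [a]) := by
        rw [hn', DFA.evalFrom_of_append, DFA.evalFrom_of_append, huniq u hu]
      rw [h1, ← hstepM, Set.mem_symmDiff, Set.mem_symmDiff, h_mem_right, h_mem_right]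
      simp [lang]
    ext w
    simp only [Set.mem_inter_iff, Set.mem_iUnion, WBs, WB, Set.mem_setOf_eq]
    constructor
    · rintro ⟨hw, u, v, ⟨q, hq, hu⟩, rfl⟩
      have hu' : M.evalFrom M.start u = q := hu
      subst hu'
      exact ⟨_, hq, u, v, rfl, (key u v hq).1 hw, rfl⟩
    · rintro ⟨q, hq, u, v, hu, hv, rfl⟩
      have hu' : M.evalFrom M.start u = q := hu
      subst hu'
      exact ⟨(key u v hq).2 hv, u, v, ⟨_, hq, rfl⟩, rfl⟩
end

section
/- Let M = (Q, Σ, q₀, δ, F) be a minimal DFA, and let B ∈ P_∼ and σ ∈ Σ be such that ⋃_{q ∈ B} K_{δ(q, σ)} ≠ ∅. Then every string w ∈ W_{B,σ} admits exactly one factorization w = uσv with u ∈ W_B and v ∈ Σ*. -/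
theorem almostEq_evalFrom {α σ : Type*} (M : DFA α σ) {q p : σ} (x : List α)
    (h : AlmostEq M q p) : AlmostEq M (M.evalFrom q x) (M.evalFrom p x) := by
  have h2 := Set.Finite.preimage (f := fun y : List α => x ++ y)
    (fun a _ b _ hab => List.append_cancel_left hab) h
  refine h2.subset ?_
  intro y hy
  simpa [Set.mem_symmDiff, rightLang, DFA.evalFrom_of_append] using hy

theorem almostEq_trans {α σ : Type*} (M : DFA α σ) {q p r : σ}
    (h : AlmostEq M q p) (h' : AlmostEq M p r) : AlmostEq M q r :=
  (Set.Finite.union h h').subset (symmDiff_triangle _ _ _)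

theorem almostEq_symm {α σ : Type*} (M : DFA α σ) {q p : σ}
    (h : AlmostEq M q p) : AlmostEq M p q := by
  unfold AlmostEq at *
  rwa [symmDiff_comm]

theorem mem_WB {α σ : Type*} (M : DFA α σ) (B : Set σ) (u : List α) :
    u ∈ WB M B ↔ M.evalFrom M.start u ∈ B := by
  simp [WB, leftLang]

theorem WB_finite {α σ : Type*} [Fintype σ] (M : DFA α σ) (B : Set σ) (hB : B ∈ Psim M) :
    (WB M B).Finite :=
  (Set.toFinite B).biUnion fun q hq => hB.2 q hq

theorem WB_prefix {α σ : Type*} [Fintype σ] (M : DFA α σ) (B : Set σ) (hB : B ∈ Psim M)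
    (u z : List α) (hu : u ∈ WB M B) (huz : u ++ z ∈ WB M B) : z = [] := by
  by_contra hz
  have hz' : 0 < z.length := List.length_pos_iff.mpr hz
  have key : ∀ n : ℕ, ∃ t, t ∈ WB M B ∧ t ++ z ∈ WB M B ∧ n ≤ t.length := by
    intro n
    induction n with
    | zero => exact ⟨u, hu, huz, Nat.zero_le _⟩
    | succ n ih =>
      obtain ⟨t, h1, h2, h3⟩ := ih
      refine ⟨t ++ z, h2, ?_, by rw [List.length_append]; omega⟩
      obtain ⟨⟨q, rfl⟩, -⟩ := hB
      rw [mem_WB] at *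
      rw [DFA.evalFrom_of_append]
      have h4 : AlmostEq M (M.evalFrom M.start t) (M.evalFrom M.start (t ++ z)) :=
        almostEq_trans M (almostEq_symm M h1) h2
      have h5 := almostEq_evalFrom M z h4
      rw [← DFA.evalFrom_of_append] at h5
      exact almostEq_trans M h2 h5
  obtain ⟨N, hN⟩ := ((WB_finite M B hB).image List.length).bddAbove
  obtain ⟨t, h1, -, h3⟩ := key (N + 1)
  have := hN (Set.mem_image_of_mem _ h1)
  omega

theorem stmt17 {α σ : Type*} [Fintype α] [Fintype σ]
    (M : DFA α σ) (hM : MinimalDFA M) (B : Set σ) (a : α) (hB : B ∈ Psim M)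
    (hK : (⋃ q ∈ B, Kq M (M.step q a)).Nonempty) :
    ∀ w ∈ WBs M B a, ∃! uv : List α × List α,
      uv.1 ∈ WB M B ∧ w = uv.1 ++ a :: uv.2 := by
  rintro w ⟨u, v, hu, rfl⟩
  refine ⟨(u, v), ⟨hu, rfl⟩, ?_⟩
  rintro ⟨u', v'⟩ ⟨hu', he⟩
  simp only at hu' he
  have huu : u = u' := by
    rcases List.append_eq_append_iff.mp he with ⟨z, hz, -⟩ | ⟨z, hz, -⟩
    · subst hz
      simp [WB_prefix M B hB u z hu hu']
    · subst hz
      simp [WB_prefix M B hB u' z hu' hu]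
  subst huu
  simpa using he.symm
end
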